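/- (Lemma 1, complete monotonicity of φ₁) The function φ₁(z) = (1/z)·arctan(1/z) is completely monotone on (0, ∞): for every natural number n and every z > 0, (−1)ⁿ times the n-th derivative of φ₁ at z is nonnegative. -/

import Mathlib

open Real

/-- The partial sums `θ + ∑_{k=1}^n cos^k θ · sin (k θ) / k`, which carry the sign of the
derivatives of `z ↦ arctan (1 / z) / z` at `z = cot θ`. -/
noncomputable def cosPowSinSum (n : ℕ) (θ : ℝ) : ℝ :=
  θ + ∑ k ∈ Finset.range n, cos θ ^ (k + 1) * sin ((k + 1) * θ) / (k + 1)

lemma cosPowSinSum_succ (n : ℕ) (θ : ℝ) :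
    cosPowSinSum (n + 1) θ =
      cosPowSinSum n θ + cos θ ^ (n + 1) * sin ((n + 1) * θ) / (n + 1) := by
  simp only [cosPowSinSum, Finset.sum_range_succ, add_assoc]

lemma hasDerivAt_cosPowSinSum (n : ℕ) {θ : ℝ} (hθ : sin θ ≠ 0) :
    HasDerivAt (cosPowSinSum n) (cos θ ^ n * sin ((n + 1) * θ) / sin θ) θ := by
  induction n with
  | zero =>
    have h : cosPowSinSum 0 = id := by
      funext x
      simp [cosPowSinSum]
    rw [h]
    simpa [hθ] using hasDerivAt_id θ
  | succ n ih =>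
    have h : cosPowSinSum (n + 1) = fun x =>
        cosPowSinSum n x + cos x ^ (n + 1) * sin ((n + 1) * x) / (n + 1) :=
      funext (cosPowSinSum_succ n)
    have hn : (n : ℝ) + 1 ≠ 0 := by positivity
    have hlin : HasDerivAt (fun x : ℝ => ((n : ℝ) + 1) * x) ((n : ℝ) + 1) θ := by
      simpa using (hasDerivAt_id θ).const_mul ((n : ℝ) + 1)
    rw [h]
    refine (ih.add ((((hasDerivAt_cos θ).pow (n + 1)).mul hlin.sin).div_const _)).congr_deriv ?_
    have hadd : sin (((n + 1 : ℕ) + 1 : ℝ) * θ) =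
        sin ((n + 1) * θ) * cos θ + cos ((n + 1) * θ) * sin θ := by
      rw [← sin_add]
      push_cast
      ring_nf
    rw [hadd]
    simp only [Pi.pow_apply, Nat.add_sub_cancel]
    push_cast
    field_simp
    linear_combination (-(cos θ ^ n * sin ((n + 1) * θ))) * sin_sq_add_cos_sq θ

lemma continuous_cosPowSinSum (n : ℕ) : Continuous (cosPowSinSum n) := by
  unfold cosPowSinSum
  fun_prop

lemma cosPowSinSum_zero_right (n : ℕ) : cosPowSinSum n 0 = 0 := by
  simp [cosPowSinSum]

/-- Integrating `cos^n t · sin ((n + 1) t) / sin t` by parts leaves a nonnegative integrand. -/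
lemma monotoneOn_cosPowSinSum_sub (n : ℕ) :
    MonotoneOn (fun θ => cosPowSinSum n θ -
      cos θ ^ n / sin θ * ((1 - cos ((n + 1) * θ)) / (n + 1))) (Set.Ioo 0 (π / 2)) := by
  have hn : (n : ℝ) + 1 ≠ 0 := by positivity
  have hsin : ∀ θ ∈ Set.Ioo 0 (π / 2), 0 < sin θ := fun θ hθ =>
    sin_pos_of_pos_of_lt_pi hθ.1 (by linarith [hθ.2, pi_pos])
  have hderiv : ∀ θ ∈ Set.Ioo 0 (π / 2), HasDerivAt (fun θ => cosPowSinSum n θ -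
      cos θ ^ n / sin θ * ((1 - cos ((n + 1) * θ)) / (n + 1)))
      ((n * cos θ ^ (n - 1) * sin θ ^ 2 + cos θ ^ n * cos θ) / sin θ ^ 2 *
        ((1 - cos ((n + 1) * θ)) / (n + 1))) θ := by
    intro θ hθ
    have hs := (hsin θ hθ).ne'
    have hlin : HasDerivAt (fun x : ℝ => ((n : ℝ) + 1) * x) ((n : ℝ) + 1) θ := by
      simpa using (hasDerivAt_id θ).const_mul ((n : ℝ) + 1)
    refine ((hasDerivAt_cosPowSinSum n hs).sub
      ((((hasDerivAt_cos θ).pow n).div (hasDerivAt_sin θ) hs).mul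
        ((hlin.cos.const_sub 1).div_const _))).congr_deriv ?_
    simp only [Pi.pow_apply, Pi.div_apply]
    field_simp
    ring
  refine monotoneOn_of_deriv_nonneg (convex_Ioo _ _)
    (fun θ hθ => (hderiv θ hθ).continuousAt.continuousWithinAt) ?_ ?_
  · intro θ hθ
    rw [interior_Ioo] at hθ
    exact (hderiv θ hθ).differentiableAt.differentiableWithinAt
  · intro θ hθ
    rw [interior_Ioo] at hθ
    rw [(hderiv θ hθ).deriv]
    have hc : 0 ≤ cos θ := cos_nonneg_of_mem_Icc ⟨by linarith [hθ.1, pi_pos], hθ.2.le⟩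
    have h1 : 0 ≤ 1 - cos ((n + 1) * θ) := sub_nonneg.2 (cos_le_one _)
    positivity

lemma cosPowSinSum_nonneg (n : ℕ) {θ : ℝ} (hθ : θ ∈ Set.Ioo 0 (π / 2)) :
    0 ≤ cosPowSinSum n θ := by
  have hlower : ∀ ε ∈ Set.Ioo 0 θ,
      cosPowSinSum n ε - ((n : ℝ) + 1) * π / 4 * ε ≤ cosPowSinSum n θ := by
    intro ε hε
    have hε' : ε ∈ Set.Ioo 0 (π / 2) := ⟨hε.1, hε.2.trans hθ.2⟩
    have hmono := monotoneOn_cosPowSinSum_sub n hε' hθ hε.2.le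
    simp only at hmono
    have hcθ : 0 ≤ cos θ := cos_nonneg_of_mem_Icc ⟨by linarith [hθ.1, pi_pos], hθ.2.le⟩
    have hsθ : 0 < sin θ := sin_pos_of_pos_of_lt_pi hθ.1 (by linarith [hθ.2, pi_pos])
    have hcε : 0 ≤ cos ε := cos_nonneg_of_mem_Icc ⟨by linarith [hε'.1, pi_pos], hε'.2.le⟩
    have h1θ : 0 ≤ 1 - cos ((n + 1) * θ) := sub_nonneg.2 (cos_le_one _)
    have hboundary : 0 ≤ cos θ ^ n / sin θ * ((1 - cos ((n + 1) * θ)) / (n + 1)) := by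
      positivity
    have hε0 : 0 < ε := hε.1
    have hsε : 2 / π * ε ≤ sin ε := mul_le_sin hε'.1.le hε'.2.le
    have hcos : 1 - cos ((n + 1) * ε) ≤ (((n : ℝ) + 1) * ε) ^ 2 / 2 := by
      linarith [one_sub_sq_div_two_le_cos (x := ((n : ℝ) + 1) * ε)]
    have h1ε : 0 ≤ 1 - cos ((n + 1) * ε) := sub_nonneg.2 (cos_le_one _)
    have hpow : cos ε ^ n ≤ 1 := pow_le_one₀ hcε (cos_le_one _)
    have hsmall : cos ε ^ n / sin ε * ((1 - cos ((n + 1) * ε)) / (n + 1)) ≤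
        ((n : ℝ) + 1) * π / 4 * ε := by
      calc cos ε ^ n / sin ε * ((1 - cos ((n + 1) * ε)) / (n + 1))
          ≤ 1 / (2 / π * ε) * (((((n : ℝ) + 1) * ε) ^ 2 / 2) / (n + 1)) := by gcongr
        _ = ((n : ℝ) + 1) * π / 4 * ε := by
            field_simp
            ring
    linarith
  have hlim : Filter.Tendsto (fun ε => cosPowSinSum n ε - ((n : ℝ) + 1) * π / 4 * ε)
      (nhdsWithin 0 (Set.Ioi 0)) (nhds 0) := by
    have hcont : Continuous fun ε => cosPowSinSum n ε - ((n : ℝ) + 1) * π / 4 * ε :=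
      (continuous_cosPowSinSum n).sub (by fun_prop)
    simpa [cosPowSinSum_zero_right] using (hcont.tendsto 0).mono_left nhdsWithin_le_nhds
  exact le_of_tendsto hlim (Filter.mem_of_superset (Ioo_mem_nhdsGT hθ.1) hlower)

lemma hasDerivAt_arctan_one_div {z : ℝ} (hz : z ≠ 0) :
    HasDerivAt (fun z : ℝ => arctan (1 / z)) (-(1 / (1 + z ^ 2))) z := by
  have h := (hasDerivAt_inv hz).arctan
  simp only [one_div]
  refine h.congr_deriv ?_
  field_simp
  ring

lemma iteratedDeriv_one_div_mul_arctan_one_div (n : ℕ) {z : ℝ} (hz : 0 < z) :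
    iteratedDeriv n (fun z : ℝ => (1 / z) * arctan (1 / z)) z =
      (-1) ^ n * n.factorial * ((z ^ (n + 1))⁻¹ * cosPowSinSum n (arctan (1 / z))) := by
  induction n generalizing z with
  | zero => simp [cosPowSinSum]
  | succ n ih =>
    have hev : iteratedDeriv n (fun z : ℝ => (1 / z) * arctan (1 / z)) =ᶠ[nhds z]
        fun z => (-1) ^ n * n.factorial *
          ((z ^ (n + 1))⁻¹ * cosPowSinSum n (arctan (1 / z))) :=
      Filter.mem_of_superset (Ioi_mem_nhds hz) fun w hw => ih hw
    have hc : 0 < cos (arctan (1 / z)) := cos_arctan_pos _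
    have hsc : cos (arctan (1 / z)) = z * sin (arctan (1 / z)) := by
      have h := tan_arctan (1 / z)
      rw [tan_eq_sin_div_cos] at h
      field_simp at h
      linarith
    have hs : sin (arctan (1 / z)) ≠ 0 := by
      intro h
      rw [h, mul_zero] at hsc
      exact hc.ne' hsc
    have hsq : sin (arctan (1 / z)) ^ 2 * (1 + z ^ 2) = 1 := by
      have h := sin_sq_add_cos_sq (arctan (1 / z))
      rw [hsc] at h
      linarith
    rw [iteratedDeriv_succ, hev.deriv_eq]
    have hcomp := (hasDerivAt_cosPowSinSum n hs).comp z (hasDerivAt_arctan_one_div hz.ne')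
    simp only [Function.comp_def] at hcomp
    have hpow := (hasDerivAt_pow (n + 1) z).fun_inv (pow_ne_zero (n + 1) hz.ne')
    rw [((hpow.fun_mul hcomp).const_mul ((-1 : ℝ) ^ n * n.factorial)).deriv, cosPowSinSum_succ,
      Nat.factorial_succ]
    have hinv : 1 / (1 + z ^ 2) = sin (arctan (1 / z)) ^ 2 :=
      (eq_div_of_mul_eq (by positivity) hsq).symm
    rw [hinv]
    generalize arctan (1 / z) = θ at *
    have hn : (n : ℝ) + 1 ≠ 0 := by positivity
    simp only [Nat.add_sub_cancel]
    push_cast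
    rw [pow_succ (cos θ) n]
    nth_rewrite 3 [hsc]
    field_simp
    ring

/-- **Lemma 1 (complete monotonicity of `φ₁`).** The function
`φ₁(z) = (1/z)·arctan(1/z)` is completely monotone on `(0, ∞)`: for every natural
number `n` and every `z > 0`, `(−1)ⁿ` times the `n`-th derivative of `φ₁` at `z`
is nonnegative. -/
theorem phi1_completelyMonotone :
    ∀ (n : ℕ) (z : ℝ), 0 < z →
      0 ≤ (-1 : ℝ) ^ n *
        iteratedDeriv n (fun z : ℝ => (1 / z) * Real.arctan (1 / z)) z := by
  intro n z hz
  have hθ : arctan (1 / z) ∈ Set.Ioo 0 (π / 2) :=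
    ⟨arctan_pos.2 (by positivity), arctan_lt_pi_div_two _⟩
  have hS := cosPowSinSum_nonneg n hθ
  have hsign : (-1 : ℝ) ^ n * (-1) ^ n = 1 := by
    rw [← mul_pow]
    norm_num
  rw [iteratedDeriv_one_div_mul_arctan_one_div n hz, mul_assoc ((-1 : ℝ) ^ n), ← mul_assoc,
    hsign, one_mul]
  positivity
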